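/- arXiv:math/0606689 — 2 statements merged into one kernel-verified Lean document; each statement's English description precedes it below -/
import Mathlib

section
/- Let A be a Noetherian domain that is a k-algebra and K a field extension of k with t.d.(K:k) < ∞. Then K ⊗_k A is a stably strong S-ring. -/
open Polynomial TensorProduct

/-- A ring satisfies MPC if its minimal primes are pairwise comaximal. -/
def MPC (A : Type*) [CommRing A] : Prop :=
  ∀ p ∈ minimalPrimes A, ∀ q ∈ minimalPrimes A, p ≠ q → p ⊔ q = ⊤

/-- A domain is an S-domain if every height-one prime `p` satisfies `ht (p[X]) = 1`. -/
def IsSDomain (D : Type*) [CommRing D] [IsDomain D] : Prop :=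
  ∀ p : PrimeSpectrum D, Order.height p = 1 →
    ∀ P : PrimeSpectrum D[X], P.asIdeal = p.asIdeal.map (C : D →+* D[X]) →
      Order.height P = 1

/-- A ring is a strong S-ring if the quotient by every prime is an S-domain. -/
def StrongSRing (A : Type*) [CommRing A] : Prop :=
  ∀ p : PrimeSpectrum A, IsSDomain (A ⧸ p.asIdeal)

/-- A ring is a stably strong S-ring if all polynomial rings over it in `n ≥ 1`
variables are strong S-rings. -/
def StablyStrongSRing (A : Type*) [CommRing A] : Prop :=
  ∀ n : ℕ, 0 < n → StrongSRing (MvPolynomial (Fin n) A)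

/-- A ring is locally finite dimensional (LFD) if every prime has finite height. -/
def LFD (A : Type*) [CommRing A] : Prop :=
  ∀ p : PrimeSpectrum A, Order.height p ≠ ⊤

/-- A ring is catenarian if it satisfies MPC, is LFD, and adjacent primes `P ⋖ Q`
satisfy `ht Q = ht P + 1`. -/
def Catenarian (A : Type*) [CommRing A] : Prop :=
  MPC A ∧ LFD A ∧
    ∀ P Q : PrimeSpectrum A, P ⋖ Q → Order.height Q = Order.height P + 1

/-- A ring is universally catenarian if all polynomial rings over it in `n ≥ 1`
variables are catenarian. -/
def UniversallyCatenarian (A : Type*) [CommRing A] : Prop :=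
  ∀ n : ℕ, 0 < n → Catenarian (MvPolynomial (Fin n) A)

/-- An S-ring: MPC together with the quotient by each minimal prime being an S-domain. -/
def SRing (A : Type*) [CommRing A] : Prop :=
  MPC A ∧ ∀ p : PrimeSpectrum A, p.asIdeal ∈ minimalPrimes A → IsSDomain (A ⧸ p.asIdeal)

/-- The transcendence degree of a `k`-algebra `A`: the supremum of the cardinalities
of algebraically independent subsets of `A` over `k`. -/
noncomputable def trdeg (k A : Type*) [CommRing k] [CommRing A] [Algebra k A] : Cardinal :=
  ⨆ s : {s : Set A // AlgebraicIndependent k ((↑) : s → A)}, Cardinal.mk s.1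

theorem Ideal.eq_bot_of_lt_of_height_le_one {R : Type*} [CommRing R] [IsDomain R] {P Q : Ideal R}
    [P.IsPrime] [Q.IsPrime] (hlt : P < Q) (hQ : Q.height ≤ 1) : P = ⊥ := by
  have h : P.height + 1 ≤ 0 + 1 := by
    simpa using (Ideal.height_add_one_le_of_lt_of_isPrime hlt).trans hQ
  rw [← Ideal.height_eq_zero_iff_eq_bot, ← nonpos_iff_eq_zero]
  exact (ENat.add_le_add_iff_right ENat.one_ne_top).mp h

theorem Ideal.exists_notMem_pow_mul_mem_of_mem_minimalPrimes {R : Type*} [CommRing R]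
    {I q : Ideal R} (hq : q ∈ I.minimalPrimes) {y : R} (hy : y ∈ q) :
    ∃ s ∉ q, ∃ n : ℕ, s * y ^ n ∈ I := by
  have := hq.1.1
  by_contra! h
  obtain ⟨P, hP, hIP, hd⟩ := Ideal.exists_le_prime_disjoint I
      (q.primeCompl ⊔ Submonoid.powers y) <| by
    rw [Set.disjoint_left]
    intro a ha ha'
    obtain ⟨s, hs, _, ⟨n, rfl⟩, rfl⟩ := Submonoid.mem_sup.mp ha'
    exact h s hs n ha
  rw [Set.disjoint_left] at hd
  have hPq : P ≤ q := fun a ha ↦ by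
    by_contra haq
    exact hd ha (Submonoid.mem_sup_left haq)
  exact hd (hq.2 ⟨hP, hIP⟩ hPq hy) (Submonoid.mem_sup_right (Submonoid.mem_powers y))

/-- In an integral extension of a Noetherian ring, minimality of a prime over a principal ideal
is inherited by all sufficiently large subalgebras. -/
theorem exists_finset_forall_comap_minimal {N D : Type*} [CommRing N] [IsNoetherianRing N]
    [CommRing D] [Algebra N D] [Algebra.IsIntegral N D] {x : D} {q : Ideal D}
    (hq : q ∈ (Ideal.span {x}).minimalPrimes) :
    ∃ T : Finset D, ∀ S : Subalgebra N D, (T : Set D) ⊆ S → ∀ P : Ideal S, P.IsPrime →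
      (∀ y : S, (y : D) = x → y ∈ P) → P ≤ q.comap S.val → P = q.comap S.val := by
  classical
  have := hq.1.1
  obtain ⟨G, hG⟩ := IsNoetherian.noetherian (q.comap (algebraMap N D))
  have key (g : N) : ∃ s d : D, g ∈ q.comap (algebraMap N D) →
      s ∉ q ∧ ∃ n : ℕ, s * algebraMap N D g ^ n = x * d := by
    by_cases hg : g ∈ q.comap (algebraMap N D)
    · obtain ⟨s, hs, n, hn⟩ := Ideal.exists_notMem_pow_mul_mem_of_mem_minimalPrimes hq hg
      obtain ⟨d, hd⟩ := Ideal.mem_span_singleton'.mp hn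
      exact ⟨s, d, fun _ ↦ ⟨hs, n, by rw [← hd, mul_comm]⟩⟩
    · exact ⟨0, 0, fun h ↦ absurd h hg⟩
  choose s d hsd using key
  refine ⟨insert x (G.image s ∪ G.image d), fun S hS P hP hxP hPq ↦ ?_⟩
  simp only [Finset.coe_insert, Finset.coe_union, Finset.coe_image, Set.insert_subset_iff,
    Set.union_subset_iff, Set.image_subset_iff] at hS
  obtain ⟨hxS, hsS, hdS⟩ := hS
  have hle : q.comap (algebraMap N D) ≤ P.comap (algebraMap N S) := by
    rw [← hG]
    refine Ideal.span_le.mpr fun g hg ↦ ?_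
    obtain ⟨hs, n, hn⟩ := hsd g (hG ▸ Ideal.subset_span hg)
    have hmem : (⟨s g, hsS hg⟩ : S) * algebraMap N S g ^ n ∈ P := by
      have : (⟨s g, hsS hg⟩ : S) * algebraMap N S g ^ n = ⟨x, hxS⟩ * ⟨d g, hdS hg⟩ :=
        Subtype.ext hn
      rw [this]
      exact P.mul_mem_right _ (hxP _ rfl)
    rcases hP.mem_or_mem hmem with h | h
    · exact absurd (hPq h) hs
    · exact hP.mem_of_pow_mem _ h
  have : Algebra.IsIntegral N S :=
    Algebra.IsIntegral.of_injective S.val Subtype.val_injective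
  by_contra hne
  have hlt := Ideal.IsIntegral.comap_lt_comap (R := N) (lt_of_le_of_ne hPq hne)
  exact hlt.not_ge hle

/-- A domain that is integral over a Noetherian ring is an S-domain. -/
theorem isSDomain_of_isIntegral (N : Type*) {D : Type*} [CommRing N] [IsNoetherianRing N]
    [CommRing D] [IsDomain D] [Algebra N D] [Algebra.IsIntegral N D] : IsSDomain D := by
  classical
  intro q hq Q₀ hQ₀
  have hqht : q.asIdeal.height = 1 := by rw [PrimeSpectrum.height_eq_orderHeight, hq]
  obtain ⟨x, hxq, hx⟩ := Submodule.exists_mem_ne_zero_of_ne_bot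
    (Ideal.ne_bot_of_height_eq_one hqht)
  have hmin (P : Ideal D) (hP : P.IsPrime) (hP0 : P ≠ ⊥) (hPq : P ≤ q.asIdeal) :
      P = q.asIdeal := by
    by_contra hne
    exact hP0 (Ideal.eq_bot_of_lt_of_height_le_one (lt_of_le_of_ne hPq hne) hqht.le)
  have hqx : q.asIdeal ∈ (Ideal.span {x}).minimalPrimes := by
    refine ⟨⟨q.2, (Ideal.span_singleton_le_iff_mem _).mpr hxq⟩, fun P ⟨hP, hxP⟩ hPq ↦ ?_⟩
    refine (hmin P hP ?_ hPq).ge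
    rintro rfl
    exact hx (by simpa using hxP)
  have hC0 : Q₀.asIdeal ≠ ⊥ := by
    intro h
    have : C x ∈ Q₀.asIdeal := hQ₀ ▸ Ideal.mem_map_of_mem _ hxq
    rw [h, Ideal.mem_bot, C_eq_zero] at this
    exact hx this
  have hmain (Q : Ideal D[X]) (hQ : Q.IsPrime) (hQ0 : Q ≠ ⊥) (hQQ : Q ≤ Q₀.asIdeal) :
      Q = Q₀.asIdeal := by
    by_cases hQD : Q.comap (C : D →+* D[X]) = ⊥
    · exfalso
      obtain ⟨f, hfQ, hf⟩ := Submodule.exists_mem_ne_zero_of_ne_bot hQ0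
      obtain ⟨T, hT⟩ := exists_finset_forall_comap_minimal (N := N) hqx
      let S : Subalgebra N D := Algebra.adjoin N ((insert x (T ∪ f.coeffs) : Finset D) : Set D)
      have hsub : ((insert x (T ∪ f.coeffs) : Finset D) : Set D) ⊆ S := Algebra.subset_adjoin
      have : IsNoetherianRing S := isNoetherianRing_of_fg ⟨_, rfl⟩
      have hxS : x ∈ S := hsub (by simp)
      let q' : Ideal S := q.asIdeal.comap S.val
      have hq' : q'.IsPrime := Ideal.comap_isPrime _ _
      let Q' : Ideal S[X] := Q.comap (mapRingHom S.val.toRingHom)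
      have hQ'p : Q'.IsPrime := Ideal.comap_isPrime _ _
      let q'X : Ideal S[X] := q'.map C
      have hq'X : q'X.IsPrime := Ideal.isPrime_map_C_of_isPrime
      have hle : Q' ≤ q'X := by
        intro g hg
        have hg' := hQQ hg
        rw [hQ₀, Ideal.mem_map_C_iff] at hg'
        refine Ideal.mem_map_C_iff.mpr fun n ↦ ?_
        change (g.coeff n : D) ∈ q.asIdeal
        simpa using hg' n
      have hxQ' : C (⟨x, hxS⟩ : S) ∉ Q' := by
        intro h
        have : x ∈ Q.comap (C : D →+* D[X]) := by simpa [Q'] using h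
        rw [hQD] at this
        exact hx this
      have hxq'X : C (⟨x, hxS⟩ : S) ∈ q'X := Ideal.mem_map_of_mem _ hxq
      have hQ'0 : Q' ≠ ⊥ := by
        intro h
        obtain ⟨g, hg⟩ : f ∈ (mapRingHom S.val.toRingHom).range := by
          rw [mem_map_range]
          intro n
          refine ⟨⟨f.coeff n, ?_⟩, rfl⟩
          by_cases hn : f.coeff n = 0
          · rw [hn]
            exact zero_mem S
          · exact hsub (by simp [coeff_mem_coeffs hn])
        have hgQ : g ∈ Q' := by
          change _ ∈ Q
          rwa [hg]
        rw [h, Ideal.mem_bot] at hgQ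
        exact hf (by rw [← hg, hgQ, map_zero])
      have hq'min : q'X ∈ (Ideal.span {C (⟨x, hxS⟩ : S)}).minimalPrimes := by
        refine ⟨⟨hq'X, (Ideal.span_singleton_le_iff_mem _).mpr hxq'X⟩,
          fun P ⟨hP, hxP⟩ hPq ↦ ?_⟩
        have hPC := hT S (fun t ht ↦ hsub (by simp [show t ∈ T from ht])) (P.comap C)
          (Ideal.comap_isPrime _ _)
          (fun y hy ↦ by
            obtain rfl : y = ⟨x, hxS⟩ := Subtype.ext hy
            exact (Ideal.span_singleton_le_iff_mem (x := C _) _).mp hxP)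
          (fun y hy ↦ by
            have := Ideal.mem_map_C_iff.mp (hPq hy) 0
            rwa [coeff_C_zero] at this)
        exact Ideal.map_le_iff_le_comap.mpr hPC.ge
      exact hQ'0 (Ideal.eq_bot_of_lt_of_height_le_one
        (lt_of_le_of_ne hle (fun h ↦ hxQ' (h ▸ hxq'X)))
        (Ideal.height_le_one_of_isPrincipal_of_mem_minimalPrimes _ _ hq'min))
    · refine le_antisymm hQQ ?_
      have hle : Q.comap (C : D →+* D[X]) ≤ q.asIdeal := fun y hy ↦ by
        have := hQQ hy
        rw [hQ₀] at this
        have := Ideal.mem_map_C_iff.mp this 0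
        rwa [coeff_C_zero] at this
      rw [hQ₀, Ideal.map_le_iff_le_comap]
      exact (hmin _ (Ideal.comap_isPrime _ _) hQD hle).ge
  rw [← Nat.cast_one, Order.height_eq_coe_iff_minimal_le_height]
  refine ⟨?_, fun Q hQ hQQ ↦ ?_⟩
  · beta_reduce
    rw [← PrimeSpectrum.height_eq_orderHeight, Nat.cast_one, Order.one_le_iff_pos, pos_iff_ne_zero]
    exact fun h ↦ hC0 (Ideal.height_eq_zero_iff_eq_bot.mp h)
  · refine (hmain Q.asIdeal Q.2 (fun h ↦ ?_) hQQ).ge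
    beta_reduce at hQ
    rw [← PrimeSpectrum.height_eq_orderHeight, h, Ideal.height_bot] at hQ
    simp at hQ

theorem strongSRing_of_isIntegral {N E : Type*} [CommRing N] [IsNoetherianRing N] [CommRing E]
    (φ : N →+* E) (hφ : φ.IsIntegral) : StrongSRing E := by
  intro p
  let _ : Algebra N (E ⧸ p.asIdeal) := ((Ideal.Quotient.mk p.asIdeal).comp φ).toAlgebra
  have : Algebra.IsIntegral N (E ⧸ p.asIdeal) :=
    ⟨hφ.trans _ _ (RingHom.isIntegral_of_surjective _ Ideal.Quotient.mk_surjective)⟩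
  exact isSDomain_of_isIntegral N

theorem RingHom.IsIntegral.mvPolynomial_map {σ N E : Type*} [CommRing N] [CommRing E]
    {φ : N →+* E} (hφ : φ.IsIntegral) :
    (MvPolynomial.map φ : MvPolynomial σ N →+* MvPolynomial σ E).IsIntegral := by
  intro p
  induction p using MvPolynomial.induction_on with
  | C a =>
    obtain ⟨f, hf, hfa⟩ := hφ a
    refine ⟨f.map MvPolynomial.C, hf.map _, ?_⟩
    rw [Polynomial.eval₂_map]
    have : (MvPolynomial.map φ : MvPolynomial σ N →+* MvPolynomial σ E).comp MvPolynomial.C =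
        MvPolynomial.C.comp φ := by ext; simp
    rw [this, ← Polynomial.hom_eval₂, hfa, map_zero]
  | add p q hp hq => exact hp.add _ hq
  | mul_X p i hp =>
    refine hp.mul _ ?_
    rw [← MvPolynomial.map_X φ i]
    exact RingHom.isIntegralElem_map _

theorem stablyStrongSRing_of_isIntegral {N E : Type*} [CommRing N] [IsNoetherianRing N]
    [CommRing E] (φ : N →+* E) (hφ : φ.IsIntegral) : StablyStrongSRing E :=
  fun _ _ ↦ strongSRing_of_isIntegral _ hφ.mvPolynomial_map

theorem Algebra.TensorProduct.isIntegral_map_id {k F K A : Type*} [CommRing k] [CommRing F]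
    [CommRing K] [CommRing A] [Algebra k F] [Algebra k K] [Algebra k A] (f : F →ₐ[k] K)
    (hf : f.toRingHom.IsIntegral) :
    (Algebra.TensorProduct.map f (AlgHom.id k A)).toRingHom.IsIntegral := by
  intro z
  induction z using TensorProduct.induction_on with
  | zero => exact RingHom.isIntegralElem_zero _
  | add y z hy hz => exact hy.add _ hz
  | tmul x a =>
    have h : x ⊗ₜ[k] a = (x ⊗ₜ[k] (1 : A)) * ((1 : K) ⊗ₜ[k] a) := by simp
    rw [h]
    refine RingHom.IsIntegralElem.mul _ ?_ ?_
    · obtain ⟨p, hp, hpx⟩ := hf x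
      refine ⟨p.map (Algebra.TensorProduct.includeLeftRingHom : F →+* F ⊗[k] A), hp.map _, ?_⟩
      rw [Polynomial.eval₂_map]
      have : (Algebra.TensorProduct.map f (AlgHom.id k A)).toRingHom.comp
          (Algebra.TensorProduct.includeLeftRingHom : F →+* F ⊗[k] A) =
          (Algebra.TensorProduct.includeLeftRingHom : K →+* K ⊗[k] A).comp f.toRingHom := by
        ext; simp
      rw [this]
      change eval₂ _ ((Algebra.TensorProduct.includeLeftRingHom : K →+* K ⊗[k] A) x) p = 0
      rw [← Polynomial.hom_eval₂, hpx, map_zero]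
    · have : (1 : K) ⊗ₜ[k] a =
          (Algebra.TensorProduct.map f (AlgHom.id k A)).toRingHom (1 ⊗ₜ[k] a) := by simp
      rw [this]
      exact RingHom.isIntegralElem_map _

/-- If `A` is a Noetherian domain over `k` and `K/k` is a field
extension of finite transcendence degree, then `K ⊗ₖ A` is a stably strong
S-ring. -/
theorem stmt18 {k K A : Type*} [Field k] [Field K] [Algebra k K] [CommRing A]
    [IsDomain A] [IsNoetherianRing A] [Algebra k A]
    (htd : trdeg k K < Cardinal.aleph0) :
    StablyStrongSRing (K ⊗[k] A) := by
  obtain ⟨s, hs⟩ := exists_isTranscendenceBasis k K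
  have hfin : s.Finite := by
    rw [← Cardinal.lt_aleph0_iff_set_finite]
    exact (le_ciSup (f := fun s : {s : Set K // AlgebraicIndependent k ((↑) : s → K)} ↦
      Cardinal.mk s.1) Cardinal.bddAbove_of_small ⟨s, hs.1⟩).trans_lt htd
  let F := IntermediateField.adjoin k (Set.range ((↑) : s → K))
  have halg : Algebra.IsAlgebraic F K := hs.isAlgebraic_field
  have hess : Algebra.EssFiniteType k F :=
    IntermediateField.essFiniteType_iff.mpr
      (IntermediateField.fg_adjoin_of_finite (by rwa [Subtype.range_coe]))
  have hN : IsNoetherianRing (A ⊗[k] F) := Algebra.EssFiniteType.isNoetherianRing A (A ⊗[k] F)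
  have : IsNoetherianRing (F ⊗[k] A) :=
    isNoetherianRing_of_ringEquiv _ (Algebra.TensorProduct.comm k A F).toRingEquiv
  have hint : Algebra.IsIntegral F K := inferInstance
  exact stablyStrongSRing_of_isIntegral _
    (Algebra.TensorProduct.isIntegral_map_id F.val hint.isIntegral)
end

section
/- Let K and L be field extensions of a field k such that t.d.(K:k) < ∞. Then K ⊗_k L is universally catenarian. -/
open Polynomial TensorProduct

section SpectrumMaps

variable {R S : Type*} [CommRing R] [CommRing S] [Algebra R S]

/-- If every element of `S` is integral over `R` up to a factor in `R` that is invertible in `S`,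
there are no inclusions between distinct primes of `S` over the same prime of `R`. -/
theorem PrimeSpectrum.comap_strictMono_of_exists_isIntegral_smul
    (h : ∀ x : S, ∃ m : R, IsUnit (algebraMap R S m) ∧ IsIntegral R (m • x)) :
    StrictMono (PrimeSpectrum.comap (algebraMap R S)) := by
  intro P Q hPQ
  obtain ⟨x, hxQ, hxP⟩ := SetLike.exists_of_lt (show P.asIdeal < Q.asIdeal from hPQ)
  obtain ⟨m, hm, hint⟩ := h x
  refine Ideal.comap_lt_comap_of_integral_mem_sdiff (x := m • x) hPQ.le ⟨?_, ?_⟩ hint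
  · rw [Algebra.smul_def]
    exact Q.asIdeal.mul_mem_left _ hxQ
  · rw [Algebra.smul_def]
    intro hmem
    exact hxP ((P.isPrime.mem_or_mem hmem).resolve_left
      fun hmP ↦ P.isPrime.ne_top (Ideal.eq_top_of_isUnit_mem _ hmP hm))

theorem PrimeSpectrum.comap_strictMono_of_isIntegral [Algebra.IsIntegral R S] :
    StrictMono (PrimeSpectrum.comap (algebraMap R S)) :=
  comap_strictMono_of_exists_isIntegral_smul
    fun x ↦ ⟨1, by simp, Algebra.IsIntegral.isIntegral _⟩

theorem PrimeSpectrum.height_comap_of_hasGoingDown [Algebra.HasGoingDown R S]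
    (hf : StrictMono (PrimeSpectrum.comap (algebraMap R S))) (P : PrimeSpectrum S) :
    Order.height P = Order.height (PrimeSpectrum.comap (algebraMap R S) P) := by
  refine Order.height_eq_of_strictMono _ hf (fun Q q hq ↦ ?_) P
  have : Q.asIdeal.LiesOver (PrimeSpectrum.comap (algebraMap R S) Q).asIdeal := ⟨rfl⟩
  obtain ⟨P', hlt, hP', hover⟩ := Ideal.exists_ideal_lt_liesOver_of_lt Q.asIdeal
    (show q.asIdeal < (PrimeSpectrum.comap (algebraMap R S) Q).asIdeal from hq)
  exact ⟨⟨P', hP'⟩, hlt, PrimeSpectrum.ext hover.over.symm⟩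

theorem PrimeSpectrum.coheight_comap_of_isIntegral [Algebra.IsIntegral R S]
    (P : PrimeSpectrum S) :
    Order.coheight P = Order.coheight (PrimeSpectrum.comap (algebraMap R S) P) := by
  refine Order.coheight_eq_of_strictMono _ comap_strictMono_of_isIntegral (fun Q q hq ↦ ?_) P
  have : Q.asIdeal.LiesOver (PrimeSpectrum.comap (algebraMap R S) Q).asIdeal := ⟨rfl⟩
  obtain ⟨P', hlt, hP', hover⟩ := Ideal.exists_ideal_gt_liesOver_of_lt Q.asIdeal
    (show (PrimeSpectrum.comap (algebraMap R S) Q).asIdeal < q.asIdeal from hq)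
  exact ⟨⟨P', hP'⟩, hlt, PrimeSpectrum.ext hover.over.symm⟩

theorem PrimeSpectrum.comap_quotientMk_strictMono (I : Ideal R) :
    StrictMono (PrimeSpectrum.comap (Ideal.Quotient.mk I)) := by
  have : Algebra.IsIntegral R (R ⧸ I) := inferInstance
  exact comap_strictMono_of_isIntegral

theorem PrimeSpectrum.coheight_comap_quotientMk (I : Ideal R) (P : PrimeSpectrum (R ⧸ I)) :
    Order.coheight (PrimeSpectrum.comap (Ideal.Quotient.mk I) P) = Order.coheight P :=
  (coheight_comap_of_isIntegral P).symm

theorem PrimeSpectrum.height_add_one_le_height_comap_quotientMk [IsDomain R] {I : Ideal R}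
    (hI : I ≠ ⊥) (P : PrimeSpectrum (R ⧸ I)) :
    Order.height P + 1 ≤ Order.height (PrimeSpectrum.comap (Ideal.Quotient.mk I) P) := by
  let φ : WithBot (PrimeSpectrum (R ⧸ I)) → PrimeSpectrum R :=
    WithBot.recBotCoe ⊥ (PrimeSpectrum.comap (Ideal.Quotient.mk I))
  have hφ : StrictMono φ := by
    intro a b hab
    induction b with
    | bot => exact absurd hab not_lt_bot
    | coe b =>
      induction a with
      | bot =>
        refine bot_lt_iff_ne_bot.mpr fun h ↦ hI (eq_bot_iff.mpr fun x hx ↦ ?_)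
        change PrimeSpectrum.comap (Ideal.Quotient.mk I) b = ⊥ at h
        have : x ∈ (PrimeSpectrum.comap (Ideal.Quotient.mk I) b).asIdeal := by
          change Ideal.Quotient.mk I x ∈ b.asIdeal
          rw [Ideal.Quotient.eq_zero_iff_mem.mpr hx]
          exact zero_mem _
        rwa [h] at this
      | coe a => exact comap_quotientMk_strictMono I (WithBot.coe_lt_coe.mp hab)
  rw [← Order.height_coe_withBot]
  exact Order.height_le_height_apply_of_strictMono φ hφ P

end SpectrumMaps

theorem MvPolynomial.height_of_isMaximal {L : Type*} [Field L] (N : ℕ)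
    (m : Ideal (MvPolynomial (Fin N) L)) [hm : m.IsMaximal] : m.height = N := by
  induction N with
  | zero =>
    have : m = ⊥ := by
      have hf : IsField (MvPolynomial (Fin 0) L) :=
        (MvPolynomial.isEmptyAlgEquiv L (Fin 0)).toMulEquiv.isField (Field.toIsField L)
      let := hf.toField
      exact (Ideal.eq_bot_or_top m).resolve_right hm.ne_top
    simp [this]
  | succ n ih =>
    let e := (MvPolynomial.finSuccEquiv L n).toRingEquiv
    let M : Ideal (MvPolynomial (Fin n) L)[X] := m.map e
    have : M.IsMaximal := Ideal.map_isMaximal_of_equiv e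
    have : (M.under (MvPolynomial (Fin n) L)).IsMaximal :=
      Polynomial.isMaximal_comap_C_of_isJacobsonRing M
    have : M.LiesOver (M.under (MvPolynomial (Fin n) L)) := ⟨rfl⟩
    rw [← e.height_map, Polynomial.height_eq_height_add_one (M.under (MvPolynomial (Fin n) L)) M,
      ih]
    simp

/-- The dimension formula for primes of a polynomial ring over a field. -/
theorem MvPolynomial.height_add_coheight {L : Type*} [Field L] (N : ℕ)
    (p : PrimeSpectrum (MvPolynomial (Fin N) L)) :
    Order.height p + Order.coheight p = N := by
  have hdim (n : ℕ) : ringKrullDim (MvPolynomial (Fin n) L) = n := by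
    simp
  apply le_antisymm
  · rw [← WithBot.coe_le_coe]
    refine le_trans ?_ (hdim N).le
    rw [ringKrullDim, Order.krullDim_eq_iSup_height_add_coheight_of_nonempty, WithBot.coe_le_coe]
    exact le_iSup (fun a ↦ Order.height a + Order.coheight a) p
  induction N with
  | zero => simp
  | succ n ih =>
    by_cases hp : p = ⊥
    · subst hp
      rw [← WithBot.coe_le_coe, WithBot.coe_add, Order.coheight_bot_eq_krullDim]
      have := hdim (n + 1)
      rw [ringKrullDim] at this
      simp [this]
    obtain ⟨f, hfp, hf⟩ := p.isPrime.exists_mem_prime_of_ne_bot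
      (fun h ↦ hp (PrimeSpectrum.ext h))
    have hfI : Ideal.span {f} ≤ p.asIdeal := by simpa [Ideal.span_le] using hfp
    have hne : Ideal.span {f} ≠ ⊤ := fun h ↦ p.isPrime.ne_top (top_le_iff.mp (h ▸ hfI))
    have : (Ideal.span {f}).IsPrime := (Ideal.span_singleton_prime hf.ne_zero).mpr hf
    obtain ⟨s, -, g, hg, hgi⟩ := exists_integral_inj_algHom_of_quotient (Ideal.span {f}) hne
    let := g.toRingHom.toAlgebra
    have : Algebra.IsIntegral (MvPolynomial (Fin s) L)
      (MvPolynomial (Fin (n + 1)) L ⧸ Ideal.span {f}) := ⟨hgi⟩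
    have : FaithfulSMul (MvPolynomial (Fin s) L)
      (MvPolynomial (Fin (n + 1)) L ⧸ Ideal.span {f}) :=
        (faithfulSMul_iff_algebraMap_injective _ _).mpr hg
    have hs : s = n := by
      have h1 : ringKrullDim (MvPolynomial (Fin (n + 1)) L ⧸ Ideal.span {f}) = s := by
        have h := PrimeSpectrum.coheight_comap_of_isIntegral (R := MvPolynomial (Fin s) L)
          (⊥ : PrimeSpectrum (MvPolynomial (Fin (n + 1)) L ⧸ Ideal.span {f}))
        have hbot : PrimeSpectrum.comap (algebraMap (MvPolynomial (Fin s) L) _)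
            (⊥ : PrimeSpectrum (MvPolynomial (Fin (n + 1)) L ⧸ Ideal.span {f})) = ⊥ :=
          PrimeSpectrum.ext (Ideal.comap_bot_of_injective _ hg)
        rw [hbot] at h
        rw [ringKrullDim, ← Order.coheight_bot_eq_krullDim, h, Order.coheight_bot_eq_krullDim]
        exact hdim s
      obtain ⟨m, hm, hpm⟩ := Ideal.exists_le_maximal _ p.isPrime.ne_top
      have h2 := Ideal.height_le_ringKrullDim_quotient_add_one (hpm hfp)
      have h3 := ringKrullDim_quotient_succ_le_of_nonZeroDivisor
        (mem_nonZeroDivisors_of_ne_zero hf.ne_zero)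
      rw [MvPolynomial.height_of_isMaximal] at h2
      rw [h1, hdim] at h3
      rw [h1] at h2
      have h2' : n + 1 ≤ s + 1 := by exact_mod_cast h2
      have h3' : s + 1 ≤ n + 1 := by exact_mod_cast h3
      omega
    subst hs
    obtain ⟨P, rfl⟩ : ∃ P, PrimeSpectrum.comap (Ideal.Quotient.mk (Ideal.span {f})) P = p := by
      rw [← Set.mem_range, range_comap_of_surjective _ _ Ideal.Quotient.mk_surjective]
      simpa [PrimeSpectrum.mem_zeroLocus] using hfp
    have hP := ih (PrimeSpectrum.comap (algebraMap _ _) P)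
    rw [← PrimeSpectrum.coheight_comap_of_isIntegral,
      ← PrimeSpectrum.height_comap_of_hasGoingDown
        PrimeSpectrum.comap_strictMono_of_isIntegral] at hP
    rw [PrimeSpectrum.coheight_comap_quotientMk]
    grw [← PrimeSpectrum.height_add_one_le_height_comap_quotientMk (by simpa using hf.ne_zero)]
    push_cast
    grw [hP]
    rw [add_right_comm]

section LocalizedIntegral

variable {S D : Type*} [CommRing S] [CommRing D] [Algebra S D]

/-- If every element of `D` becomes integral over `S` after multiplication by a unit integral
over `S`, then `D` is a localization of the integral closure of `S` in `D`. -/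
theorem integralClosure_isLocalization_of_exists_isUnit
    (h : ∀ x : D, ∃ d : D, IsUnit d ∧ IsIntegral S d ∧ IsIntegral S (d * x)) :
    IsLocalization ((IsUnit.submonoid D).comap (algebraMap (integralClosure S D) D)) D where
  map_units y := y.2
  surj z := by
    obtain ⟨d, hd, hdS, hdz⟩ := h z
    exact ⟨⟨⟨d * z, hdz⟩, ⟨⟨d, hdS⟩, hd⟩⟩, mul_comm _ _⟩
  exists_of_eq {x y} hxy := ⟨1, by rw [Subtype.ext hxy]⟩

theorem PrimeSpectrum.comap_strictMono_of_exists_isUnit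
    (h : ∀ x : D, ∃ d : D, IsUnit d ∧ IsIntegral S d ∧ IsIntegral S (d * x)) :
    StrictMono (PrimeSpectrum.comap (algebraMap S D)) := by
  have h1 : StrictMono (PrimeSpectrum.comap (algebraMap (integralClosure S D) D)) :=
    PrimeSpectrum.comap_strictMono_of_exists_isIntegral_smul fun x ↦ by
      obtain ⟨d, hd, hdS, hdx⟩ := h x
      exact ⟨⟨d, hdS⟩, hd, isIntegral_algebraMap (x := (⟨d * x, hdx⟩ : integralClosure S D))⟩
  have h2 : StrictMono (PrimeSpectrum.comap (algebraMap S (integralClosure S D))) :=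
    PrimeSpectrum.comap_strictMono_of_isIntegral
  rw [IsScalarTower.algebraMap_eq S (integralClosure S D) D]
  exact h2.comp h1

theorem Algebra.HasGoingDown.of_exists_isUnit [IsDomain D] [IsIntegrallyClosed S]
    [FaithfulSMul S D]
    (h : ∀ x : D, ∃ d : D, IsUnit d ∧ IsIntegral S d ∧ IsIntegral S (d * x)) :
    Algebra.HasGoingDown S D := by
  have hloc := integralClosure_isLocalization_of_exists_isUnit h
  have : Module.Flat (integralClosure S D) D := IsLocalization.flat D
    ((IsUnit.submonoid D).comap (algebraMap (integralClosure S D) D))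
  have : FaithfulSMul S (integralClosure S D) := by
    rw [faithfulSMul_iff_algebraMap_injective]
    have := FaithfulSMul.algebraMap_injective S D
    rw [IsScalarTower.algebraMap_eq S (integralClosure S D) D, RingHom.coe_comp] at this
    exact Function.Injective.of_comp this
  exact Algebra.HasGoingDown.trans S (integralClosure S D) D

end LocalizedIntegral

theorem Order.height_eq_one_of_bot_covBy {α : Type*} [PartialOrder α] [OrderBot α] {a : α}
    (h : ⊥ ⋖ a) : Order.height a = 1 := by
  apply le_antisymm
  · refine (Order.height_le_coe_iff (n := 1)).mpr fun y hy ↦ ?_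
    obtain rfl : y = ⊥ := by
      by_contra hne
      exact h.2 (bot_lt_iff_ne_bot.mpr hne) hy
    simp
  · simpa using Order.height_add_one_le h.1

/-- In an algebra that is, up to inverting elements, integral over a polynomial ring over a field,
adjacent primes contract to primes whose coheights differ by one. -/
theorem MvPolynomial.coheight_comap_eq_of_covBy {L : Type*} [Field L] {N : ℕ} {A : Type*}
    [CommRing A] [Algebra (MvPolynomial (Fin N) L) A]
    (h : ∀ x : A, ∃ m : MvPolynomial (Fin N) L,
      IsUnit (algebraMap (MvPolynomial (Fin N) L) A m) ∧
        IsIntegral (MvPolynomial (Fin N) L) (m • x))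
    {P Q : PrimeSpectrum A} (hPQ : P ⋖ Q) :
    Order.coheight (PrimeSpectrum.comap (algebraMap (MvPolynomial (Fin N) L) A) P) =
      Order.coheight (PrimeSpectrum.comap (algebraMap (MvPolynomial (Fin N) L) A) Q) + 1 := by
  set R := MvPolynomial (Fin N) L
  set p := PrimeSpectrum.comap (algebraMap R A) P
  let E := R ⧸ p.asIdeal
  let D := A ⧸ P.asIdeal
  obtain ⟨s, -, g, hg, hgi⟩ := exists_integral_inj_algHom_of_quotient p.asIdeal p.isPrime.ne_top
  let S := MvPolynomial (Fin s) L
  let ψ : E →+* D := Ideal.quotientMap P.asIdeal (algebraMap R A) le_rfl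
  have hψ : Function.Injective ψ := Ideal.quotientMap_injective
  let : Algebra S E := g.toRingHom.toAlgebra
  let : Algebra E D := ψ.toAlgebra
  let : Algebra S D := (ψ.comp g.toRingHom).toAlgebra
  have : IsScalarTower S E D := .of_algebraMap_eq' rfl
  have : Algebra.IsIntegral S E := ⟨hgi⟩
  have : FaithfulSMul S D := (faithfulSMul_iff_algebraMap_injective _ _).mpr (hψ.comp hg)
  have hint {x : D} (hx : IsIntegral R x) : IsIntegral S x :=
    isIntegral_trans (A := E) x
      (RingHom.IsIntegralElem.of_comp (f := Ideal.Quotient.mk p.asIdeal) (g := ψ) hx)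
  have hSD (x : D) : ∃ d : D, IsUnit d ∧ IsIntegral S d ∧ IsIntegral S (d * x) := by
    obtain ⟨x, rfl⟩ := Ideal.Quotient.mk_surjective x
    obtain ⟨m, hm, hmx⟩ := h x
    refine ⟨algebraMap R D m, hm.map (Ideal.Quotient.mk P.asIdeal),
      hint isIntegral_algebraMap, hint ?_⟩
    have := hmx.map (Ideal.Quotient.mkₐ R P.asIdeal)
    rwa [map_smul, Algebra.smul_def] at this
  have : Algebra.HasGoingDown S D := .of_exists_isUnit hSD
  obtain ⟨Q', rfl⟩ : ∃ Q', PrimeSpectrum.comap (Ideal.Quotient.mk P.asIdeal) Q' = Q := by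
    rw [← Set.mem_range, range_comap_of_surjective _ _ Ideal.Quotient.mk_surjective]
    simpa [PrimeSpectrum.mem_zeroLocus] using! hPQ.le
  have hbot : PrimeSpectrum.comap (Ideal.Quotient.mk P.asIdeal) ⊥ = P :=
    PrimeSpectrum.ext (Ideal.mk_ker)
  have hcov : ⊥ ⋖ Q' := by
    refine ⟨bot_lt_iff_ne_bot.mpr ?_, fun W hW hWQ ↦ ?_⟩
    · rintro rfl
      exact hPQ.ne hbot.symm
    · refine hPQ.2 ?_ (PrimeSpectrum.comap_quotientMk_strictMono _ hWQ)
      have := PrimeSpectrum.comap_quotientMk_strictMono _ hW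
      rwa [hbot] at this
  have h1 := MvPolynomial.height_add_coheight s (PrimeSpectrum.comap (algebraMap S D) Q')
  rw [← PrimeSpectrum.height_comap_of_hasGoingDown
    (PrimeSpectrum.comap_strictMono_of_exists_isUnit hSD),
    Order.height_eq_one_of_bot_covBy hcov] at h1
  have h2 := PrimeSpectrum.coheight_comap_of_isIntegral (R := S) (PrimeSpectrum.comap ψ Q')
  have h3 := PrimeSpectrum.coheight_comap_quotientMk p.asIdeal (PrimeSpectrum.comap ψ Q')
  have h4 := PrimeSpectrum.coheight_comap_of_isIntegral (R := S) (⊥ : PrimeSpectrum E)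
  have hbotE : PrimeSpectrum.comap (Ideal.Quotient.mk p.asIdeal) (⊥ : PrimeSpectrum E) = p :=
    PrimeSpectrum.ext (Ideal.mk_ker)
  have h5 := PrimeSpectrum.coheight_comap_quotientMk p.asIdeal ⊥
  have hbotS : PrimeSpectrum.comap (algebraMap S E) ⊥ = ⊥ :=
    PrimeSpectrum.ext (Ideal.comap_bot_of_injective _ hg)
  have h6 := MvPolynomial.height_add_coheight s (⊥ : PrimeSpectrum S)
  rw [hbotE, h4, hbotS] at h5
  rw [Order.height_bot, zero_add] at h6
  change Order.coheight p = Order.coheight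
    (PrimeSpectrum.comap (Ideal.Quotient.mk p.asIdeal) (PrimeSpectrum.comap ψ Q')) + 1
  rw [h3, h2, h5, h6, ← h1, add_comm]
  rfl

/-- The height condition for catenarity holds for flat algebras that are, up to inverting elements,
integral over a polynomial ring over a field. -/
theorem MvPolynomial.height_of_flat_of_exists_isIntegral_smul {L : Type*} [Field L] {N : ℕ}
    {A : Type*} [CommRing A] [Algebra (MvPolynomial (Fin N) L) A]
    [Module.Flat (MvPolynomial (Fin N) L) A]
    (h : ∀ x : A, ∃ m : MvPolynomial (Fin N) L,
      IsUnit (algebraMap (MvPolynomial (Fin N) L) A m) ∧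
        IsIntegral (MvPolynomial (Fin N) L) (m • x)) :
    LFD A ∧ ∀ P Q : PrimeSpectrum A, P ⋖ Q → Order.height Q = Order.height P + 1 := by
  have hh (P : PrimeSpectrum A) : Order.height P +
      Order.coheight (PrimeSpectrum.comap (algebraMap (MvPolynomial (Fin N) L) A) P) = N := by
    rw [PrimeSpectrum.height_comap_of_hasGoingDown
      (PrimeSpectrum.comap_strictMono_of_exists_isIntegral_smul h)]
    exact MvPolynomial.height_add_coheight N _
  refine ⟨fun P hP ↦ ?_, fun P Q hPQ ↦ ?_⟩
  · simpa [hP] using hh P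
  · have h1 := MvPolynomial.coheight_comap_eq_of_covBy h hPQ
    have hP := hh P
    have hQ := hh Q
    generalize Order.coheight (PrimeSpectrum.comap (algebraMap (MvPolynomial (Fin N) L) A) Q) = b
      at h1 hQ
    rw [h1, ← hQ] at hP
    have hb : b ≠ ⊤ := by
      rintro rfl
      simp at hQ
    rw [add_comm b, ← add_assoc] at hP
    exact (WithTop.add_right_cancel hb hP).symm

section Separable

variable {C A : Type*} [CommRing C] [IsDomain C] [CommRing A] [Algebra C A]

theorem Ideal.isTorsionFree_quotient_of_comap_eq_bot {P : Ideal A} [P.IsPrime]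
    (hP : P.comap (algebraMap C A) = ⊥) : Module.IsTorsionFree C (A ⧸ P) := by
  suffices FaithfulSMul C (A ⧸ P) from inferInstance
  refine (faithfulSMul_iff_algebraMap_injective C (A ⧸ P)).mpr ?_
  rw [injective_iff_map_eq_zero]
  intro c hc
  have : c ∈ P.comap (algebraMap C A) :=
    (Ideal.Quotient.eq_zero_iff_mem (I := P)).mp hc
  rwa [hP] at this

variable [IsIntegrallyClosed C]

theorem Ideal.aeval_mem_iff_minpoly_dvd {P : Ideal A} [P.IsPrime]
    (hP : P.comap (algebraMap C A) = ⊥) {x : A} (hx : IsIntegral C x) (g : C[X]) :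
    aeval x g ∈ P ↔ minpoly C (Ideal.Quotient.mk P x) ∣ g := by
  have := Ideal.isTorsionFree_quotient_of_comap_eq_bot hP
  rw [← Ideal.Quotient.eq_zero_iff_mem]
  refine Iff.trans ?_ (minpoly.isIntegrallyClosed_dvd_iff (hx.map (Ideal.Quotient.mkₐ C P)) g)
  exact (congrArg (· = 0) (aeval_algHom_apply (Ideal.Quotient.mkₐ C P) x g)).to_iff.symm

theorem Ideal.aeval_mem_of_separable {P Q : Ideal A} [P.IsPrime] [Q.IsPrime]
    (hP : P.comap (algebraMap C A) = ⊥) (hQ : Q.comap (algebraMap C A) = ⊥) (hPQ : P ⊔ Q ≠ ⊤)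
    {x : A} {h : C[X]} (hm : h.Monic) (hs : h.Separable) (hh : aeval x h = 0) {f : C[X]}
    (hf : aeval x f ∈ P) : aeval x f ∈ Q := by
  have hx : IsIntegral C x := ⟨h, hm, hh⟩
  have := Ideal.isTorsionFree_quotient_of_comap_eq_bot hQ
  have hq := minpoly.prime_of_isIntegrallyClosed (hx.map (Ideal.Quotient.mkₐ C Q))
  change Prime (minpoly C (Ideal.Quotient.mk Q x)) at hq
  have mem_P (g : C[X]) := Ideal.aeval_mem_iff_minpoly_dvd hP hx g
  have mem_Q (g : C[X]) := Ideal.aeval_mem_iff_minpoly_dvd hQ hx g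
  generalize minpoly C (Ideal.Quotient.mk P x) = p at mem_P
  generalize minpoly C (Ideal.Quotient.mk Q x) = q at mem_Q hq
  rw [mem_P] at hf
  rw [mem_Q]
  refine dvd_trans ?_ hf
  by_contra hqp
  have hqh : q ∣ h := (mem_Q h).mp (hh ▸ Q.zero_mem)
  obtain ⟨r, rfl⟩ : p ∣ h := (mem_P h).mp (hh ▸ P.zero_mem)
  obtain ⟨t, rfl⟩ := (hq.dvd_or_dvd hqh).resolve_left hqp
  obtain ⟨u, v, huv⟩ := (hs.of_dvd (Dvd.intro t (mul_assoc p q t))).isCoprime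
  refine hPQ ((Ideal.eq_top_iff_one _).mpr ?_)
  have := congrArg (aeval x) huv
  rw [map_add, map_one] at this
  rw [← this]
  exact add_mem (Ideal.mem_sup_left ((mem_P _).mpr (dvd_mul_left _ _)))
    (Ideal.mem_sup_right ((mem_Q _).mpr (dvd_mul_left _ _)))

theorem Ideal.comap_eq_bot_of_mem_minimalPrimes_of_flat {C A : Type*} [CommRing C] [IsDomain C]
    [CommRing A] [Algebra C A] [Module.Flat C A] {P : Ideal A} (hP : P ∈ minimalPrimes A) :
    P.comap (algebraMap C A) = ⊥ := by
  rw [eq_bot_iff]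
  intro c hc
  by_contra hne
  refine Set.disjoint_left.mp (Ideal.disjoint_nonZeroDivisors_of_mem_minimalPrimes hP) hc ?_
  refine mem_nonZeroDivisors_iff_right.mpr fun a ha ↦ ?_
  refine (Module.Flat.isSMulRegular_of_nonZeroDivisors (mem_nonZeroDivisors_of_ne_zero hne)) ?_
  simpa [Algebra.smul_def, mul_comm] using ha

end Separable

section MinimalPrimes

variable {F K C : Type*} [Field F] [Field K] [Algebra F K]

theorem IsSeparable.exists_aeval_eq_aeval_eq {α β : K} (hα : IsSeparable F α)
    (hβ : IsSeparable F β) :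
    ∃ γ : K, IsSeparable F γ ∧ ∃ f g : F[X], aeval γ f = α ∧ aeval γ g = β := by
  let E := IntermediateField.adjoin F {α, β}
  have : Algebra.IsSeparable F E :=
    IntermediateField.isSeparable_adjoin_pair_of_isSeparable F K hα hβ
  have : FiniteDimensional F E := IntermediateField.finiteDimensional_adjoin <| by
    rintro x (rfl | rfl)
    exacts [hα.isIntegral, hβ.isIntegral]
  obtain ⟨γ, hγ⟩ := Field.exists_primitive_element F E
  have hr (x : E) : ∃ f : F[X], aeval (γ : K) f = x := by
    have hx : x ∈ (IntermediateField.adjoin F {γ}).toSubalgebra := by simp [hγ]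
    rw [IntermediateField.adjoin_simple_toSubalgebra_of_isAlgebraic
      (Algebra.IsAlgebraic.isAlgebraic γ), Algebra.adjoin_singleton_eq_range_aeval] at hx
    obtain ⟨f, rfl⟩ := hx
    exact ⟨f, (aeval_algebraMap_apply K γ f)⟩
  obtain ⟨f, hf⟩ := hr ⟨α, IntermediateField.subset_adjoin F _ (by simp)⟩
  obtain ⟨g, hg⟩ := hr ⟨β, IntermediateField.subset_adjoin F _ (by simp)⟩
  refine ⟨γ, ?_, f, g, hf, hg⟩
  have := Algebra.IsSeparable.isSeparable F γ
  rwa [IsSeparable, ← minpoly.algebraMap_eq (algebraMap E K).injective γ] at this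

variable [CommRing C] [Algebra F C]

theorem TensorProduct.exists_pow_eq_aeval_tmul [Nontrivial C] [Algebra.IsAlgebraic F K]
    (q : ℕ) [ExpChar F q] (a : C ⊗[F] K) :
    ∃ α : K, IsSeparable F α ∧ ∃ (m : ℕ) (f : C[X]),
      a ^ q ^ m = aeval ((1 : C) ⊗ₜ[F] α) f := by
  have : ExpChar (C ⊗[F] K) q := expChar_of_injective_algebraMap (algebraMap F _).injective q
  induction a with
  | zero =>
    exact ⟨0, by simpa using isSeparable_algebraMap (F := F) (K := K) (0 : F), 0, 0, by simp⟩
  | tmul c κ =>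
    have : ExpChar (separableClosure F K) q :=
      expChar_of_injective_algebraMap (algebraMap F _).injective q
    obtain ⟨m, α, hα⟩ := IsPurelyInseparable.pow_mem (separableClosure F K) q κ
    refine ⟨α, mem_separableClosure_iff.mp α.2, m, Polynomial.C (c ^ q ^ m) * X, ?_⟩
    change (α : K) = _ at hα
    simp [Algebra.TensorProduct.tmul_pow, hα]
  | add a b ha hb =>
    obtain ⟨α, hα, m, f, hf⟩ := ha
    obtain ⟨β, hβ, n, g, hg⟩ := hb
    obtain ⟨γ, hγ, f₁, g₁, rfl, rfl⟩ := hα.exists_aeval_eq_aeval_eq hβ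
    have key (h : F[X]) : (1 : C) ⊗ₜ[F] aeval γ h =
        aeval ((1 : C) ⊗ₜ[F] γ) (h.map (algebraMap F C)) := by
      rw [aeval_map_algebraMap]
      exact (aeval_algHom_apply (Algebra.TensorProduct.includeRight : K →ₐ[F] C ⊗[F] K) γ h).symm
    refine ⟨γ, hγ, m + n, (f.comp (f₁.map (algebraMap F C))) ^ q ^ n +
      (g.comp (g₁.map (algebraMap F C))) ^ q ^ m, ?_⟩
    rw [add_pow_expChar_pow, map_add, map_pow, map_pow, aeval_comp, aeval_comp, ← key, ← key,
      ← hf, ← hg, ← pow_mul, ← pow_mul, ← pow_add, ← pow_add, add_comm n m]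

variable [IsDomain C]

/-- The minimal primes of an algebraic base change of an integrally closed domain are pairwise
comaximal. -/
theorem TensorProduct.mpc_of_isIntegrallyClosed [IsIntegrallyClosed C] [Algebra.IsAlgebraic F K] :
    MPC (C ⊗[F] K) := by
  intro P hP Q hQ hne
  by_contra hPQ
  have := hP.1.1
  have := hQ.1.1
  have hle : P ≤ Q := fun a ha ↦ by
    obtain ⟨α, hα, m, f, hf⟩ := exists_pow_eq_aeval_tmul (ringExpChar F) a
    have hq : ringExpChar F ^ m ≠ 0 := pow_ne_zero _ (expChar_ne_zero F _)
    refine hQ.1.1.mem_of_pow_mem (ringExpChar F ^ m) ?_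
    rw [hf]
    have hP' := Ideal.comap_eq_bot_of_mem_minimalPrimes_of_flat (C := C) hP
    have hQ' := Ideal.comap_eq_bot_of_mem_minimalPrimes_of_flat (C := C) hQ
    refine Ideal.aeval_mem_of_separable hP' hQ' hPQ
      ((minpoly.monic hα.isIntegral).map (algebraMap F C)) (Polynomial.Separable.map hα) ?_ ?_
    · rw [aeval_map_algebraMap]
      exact (aeval_algHom_apply (Algebra.TensorProduct.includeRight : K →ₐ[F] C ⊗[F] K) α
        (minpoly F α)).trans (by simp)
    · rw [← hf]
      exact Ideal.pow_mem_of_mem P ha _ (Nat.pos_of_ne_zero hq)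
  exact hne (hle.antisymm (hQ.2 hP.1 hle))

end MinimalPrimes

theorem Catenarian.of_ringEquiv {A B : Type*} [CommRing A] [CommRing B] (e : A ≃+* B)
    (hA : Catenarian A) : Catenarian B := by
  let E : PrimeSpectrum B ≃o PrimeSpectrum A := PrimeSpectrum.comapEquiv e.symm
  obtain ⟨h1, h2, h3⟩ := hA
  refine ⟨fun p hp q hq hpq ↦ ?_, fun p ↦ ?_, fun P Q hPQ ↦ ?_⟩
  · have hmin {p : Ideal B} (hp : p ∈ minimalPrimes B) :
        p.comap (e : A →+* B) ∈ minimalPrimes A := by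
      have := Ideal.minimalPrimes_comap_of_surjective (f := (e : A →+* B)) e.surjective hp
      rwa [show (⊥ : Ideal B).comap (e : A →+* B) = ⊥ from
        Ideal.comap_bot_of_injective (e : A →+* B) e.injective] at this
    have := h1 _ (hmin hp) _ (hmin hq) fun h ↦ hpq <|
      Ideal.comap_injective_of_surjective (e : A →+* B) e.surjective h
    rw [← Ideal.map_comap_of_surjective (e : A →+* B) e.surjective p,
      ← Ideal.map_comap_of_surjective (e : A →+* B) e.surjective q, ← Ideal.map_sup, this,
      Ideal.map_top]
  · rw [← Order.height_orderIso E]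
    exact h2 _
  · rw [← Order.height_orderIso E, ← Order.height_orderIso E P]
    exact h3 _ _ ((apply_covBy_apply_iff E).mpr hPQ)

theorem MvPolynomial.height_of_flat_of_isIntegral_of_isLocalization {L C A : Type*} [Field L]
    [CommRing C] [CommRing A] [Algebra C A] [Module.Flat C A] [Algebra.IsIntegral C A] {N : ℕ}
    [Algebra (MvPolynomial (Fin N) L) C] (M : Submonoid (MvPolynomial (Fin N) L))
    [IsLocalization M C] :
    LFD A ∧ ∀ P Q : PrimeSpectrum A, P ⋖ Q → Order.height Q = Order.height P + 1 := by
  let : Algebra (MvPolynomial (Fin N) L) A :=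
    ((algebraMap C A).comp (algebraMap (MvPolynomial (Fin N) L) C)).toAlgebra
  have : IsScalarTower (MvPolynomial (Fin N) L) C A := .of_algebraMap_eq' rfl
  have : Module.Flat (MvPolynomial (Fin N) L) C := IsLocalization.flat C M
  have : Module.Flat (MvPolynomial (Fin N) L) A := .trans _ C _
  refine MvPolynomial.height_of_flat_of_exists_isIntegral_smul (L := L) (N := N) fun x ↦ ?_
  obtain ⟨m, hm⟩ :=
    (Algebra.IsIntegral.isIntegral (R := C) x).exists_multiple_integral_of_isLocalization M
  exact ⟨m, (IsLocalization.map_units C m).map (algebraMap C A), hm⟩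

theorem TensorProduct.catenarian_of_isLocalization {F K L C : Type*} [Field F] [Field K] [Field L]
    [Algebra F K] [Algebra.IsAlgebraic F K] [CommRing C] [Nontrivial C] [Algebra F C] {N : ℕ}
    [Algebra (MvPolynomial (Fin N) L) C] (M : Submonoid (MvPolynomial (Fin N) L))
    [IsLocalization M C] : Catenarian (C ⊗[F] K) := by
  have hM : M ≤ nonZeroDivisors (MvPolynomial (Fin N) L) := le_nonZeroDivisors_of_noZeroDivisors
    fun h0 ↦ not_subsingleton C (IsLocalization.subsingleton h0)
  have : IsDomain C := IsLocalization.isDomain_of_le_nonZeroDivisors _ hM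
  have : IsIntegrallyClosed C := isIntegrallyClosed_of_isLocalization C M hM
  have : Algebra.IsIntegral F K := inferInstance
  exact ⟨TensorProduct.mpc_of_isIntegrallyClosed,
    MvPolynomial.height_of_flat_of_isIntegral_of_isLocalization (C := C) M⟩

/-- A localization of a factor of a tensor product is a localization of the tensor product; here
the latter is replaced by an isomorphic ring. -/
theorem IsLocalization.exists_tensorProduct_of_ringEquiv {k P F W R : Type*} [CommRing k]
    [CommRing P] [CommRing F] [CommRing W] [CommRing R] [Algebra k P] [Algebra k F] [Algebra k W]
    [Algebra P F] [IsScalarTower k P F] (M : Submonoid P) [IsLocalization M F]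
    (e : P ⊗[k] W ≃+* R) :
    ∃ (_ : Algebra R (F ⊗[k] W)) (M' : Submonoid R), IsLocalization M' (F ⊗[k] W) := by
  let φ := Algebra.TensorProduct.map (IsScalarTower.toAlgHom k P F) (AlgHom.id k W)
  let : Algebra (P ⊗[k] W) (F ⊗[k] W) := φ.toAlgebra
  have : IsScalarTower P (P ⊗[k] W) (F ⊗[k] W) := .of_algebraMap_eq fun p ↦ by
    change _ = φ (p ⊗ₜ 1)
    simp [φ, Algebra.TensorProduct.algebraMap_apply]
  have := IsLocalization.tensorProduct_tensorProduct k W M F <| RingHom.ext fun w ↦ by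
    change φ (1 ⊗ₜ w) = 1 ⊗ₜ w
    simp [φ]
  exact ⟨_, _, IsLocalization.isLocalization_of_base_ringEquiv
    (Algebra.algebraMapSubmonoid (P ⊗[k] W) M) (F ⊗[k] W) e⟩

theorem catenarian_tensorProduct_mvPolynomial {k K L ι : Type*} [Field k] [Field K]
    [Field L] [Algebra k K] [Algebra k L] [Finite ι] {x : ι → K} (hx : IsTranscendenceBasis k x)
    (n : ℕ) : Catenarian (K ⊗[k] MvPolynomial (Fin n) L) := by
  let P := MvPolynomial ι k
  let W := MvPolynomial (Fin n) L
  let F := FractionRing P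
  let : Algebra P K := (MvPolynomial.aeval x).toAlgebra
  have : FaithfulSMul P K := (faithfulSMul_iff_algebraMap_injective _ _).mpr hx.1
  have : IsScalarTower k P K := .of_algebraMap_eq' (MvPolynomial.aeval x).comp_algebraMap.symm
  let : Algebra F K := FractionRing.liftAlgebra P K
  have : IsScalarTower P F K := FractionRing.isScalarTower_liftAlgebra P K
  have : IsScalarTower k F K := .to₁₃₄ k P F K
  have : Algebra.IsAlgebraic F K := hx.isAlgebraic_iff.mpr fun i ↦ by
    rw [← MvPolynomial.aeval_X (R := k) x i]
    change IsAlgebraic F (algebraMap P K (MvPolynomial.X i))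
    rw [IsScalarTower.algebraMap_apply P F K]
    exact isAlgebraic_algebraMap _
  let e : P ⊗[k] W ≃+* MvPolynomial (Fin (Nat.card (Fin n ⊕ ι))) L :=
    ((MvPolynomial.rTensorAlgEquiv.toRingEquiv.trans
      (MvPolynomial.mapEquiv (Fin n) ((Algebra.TensorProduct.comm k P L).toRingEquiv.trans
        (MvPolynomial.algebraTensorAlgEquiv k L).toRingEquiv))).trans
      (MvPolynomial.sumAlgEquiv L (Fin n) ι).symm.toRingEquiv).trans
      (MvPolynomial.renameEquiv L (Finite.equivFin (Fin n ⊕ ι))).toRingEquiv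
  obtain ⟨_, M, _⟩ :=
    IsLocalization.exists_tensorProduct_of_ringEquiv (F := F) (nonZeroDivisors P) e
  exact (TensorProduct.catenarian_of_isLocalization (F := F) (K := K) M).of_ringEquiv
    ((Algebra.TensorProduct.comm F (F ⊗[k] W) K).toRingEquiv.trans
      (Algebra.TensorProduct.cancelBaseChange k F F K W).toRingEquiv)

/-- If `K`, `L` are field extensions of `k` with
`t.d.(K : k) < ∞`, then `K ⊗ₖ L` is universally catenarian. -/
theorem stmt19 {k K L : Type*} [Field k] [Field K] [Field L] [Algebra k K]
    [Algebra k L] (htd : trdeg k K < Cardinal.aleph0) :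
    UniversallyCatenarian (K ⊗[k] L) := by
  obtain ⟨s, hs⟩ := exists_isTranscendenceBasis k K
  have : Finite s := by
    rw [← Cardinal.lt_aleph0_iff_finite]
    exact (le_ciSup Cardinal.bddAbove_of_small
      (⟨s, hs.1⟩ : {s : Set K // AlgebraicIndependent k ((↑) : s → K)})).trans_lt htd
  intro n _
  exact (catenarian_tensorProduct_mvPolynomial hs n).of_ringEquiv
    MvPolynomial.rTensorAlgEquiv.toRingEquiv
end
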